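/- arXiv:2508.15446 — 2 statements merged into one kernel-verified Lean document; each statement's English description precedes it below -/
import Mathlib

section
/- Let Ω ⊂ ℝ^d (d ≥ 1) be a bounded domain, p ∈ (0,1), a, b ∈ L²(Ω) with a < b a.e., and ū ∈ U_ad. Then η ∈ ∂̂(j + I_{U_ad})(ū) if and only if: η(x) ≥ p·|ū(x)|^{p−2}·ū(x) for a.e. x ∈ {ū = b} ∩ {ū ≠ 0}, η(x) ≤ p·|ū(x)|^{p−2}·ū(x) for a.e. x ∈ {ū = a} ∩ {ū ≠ 0}, and η(x) = p·|ū(x)|^{p−2}·ū(x) for a.e. x ∈ {a < ū < b} ∩ {ū ≠ 0} (here |ū|^{p−2}ū means sign(ū)·|ū|^{p−1}, and no constraint is imposed on the set {ū = 0}). -/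
open MeasureTheory Filter Topology RealInnerProductSpace
open scoped Classical

/-- `η` belongs to the Fréchet subdifferential `∂̂g(u)` of `g : U → ℝ ∪ {+∞} ⊆ EReal`:
`liminf_{‖h‖ → 0} (g(u + h) − g(u) − ⟨η, h⟩)/‖h‖ ≥ 0`. -/
def InFrechetSubdiff {U : Type*} [NormedAddCommGroup U] [InnerProductSpace ℝ U]
    (g : U → EReal) (u η : U) : Prop :=
  0 ≤ Filter.liminf
      (fun h : U => (g (u + h) - g u - (((⟪η, h⟫ : ℝ)) : EReal)) * ((‖h‖⁻¹ : ℝ) : EReal))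
      (nhdsWithin 0 {(0 : U)}ᶜ)


lemma inFrechetSubdiff_add_indicator_iff {U : Type*} [NormedAddCommGroup U]
    [InnerProductSpace ℝ U] (J : U → ℝ) (P : U → Prop) (u η : U) (hu : P u) :
    InFrechetSubdiff (fun v => ((J v : ℝ) : EReal) + (if P v then (0 : EReal) else ⊤)) u η ↔
      ∀ ε > 0, ∀ᶠ h in 𝓝[≠] (0 : U), P (u + h) → -(ε * ‖h‖) ≤ J (u + h) - J u - ⟪η, h⟫ := by
  have key : ∀ h : U, P (u + h) →
      (((J (u + h) : ℝ) : EReal) + (if P (u + h) then (0 : EReal) else ⊤)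
        - (((J u : ℝ) : EReal) + (if P u then (0 : EReal) else ⊤)) - ((⟪η, h⟫ : ℝ) : EReal))
        * ((‖h‖⁻¹ : ℝ) : EReal) = (((J (u + h) - J u - ⟪η, h⟫) * ‖h‖⁻¹ : ℝ) : EReal) := by
    intro h hP
    simp only [hP, hu, if_true, add_zero]
    norm_cast
  have key' : ∀ h : U, h ≠ 0 → ¬ P (u + h) →
      (((J (u + h) : ℝ) : EReal) + (if P (u + h) then (0 : EReal) else ⊤)
        - (((J u : ℝ) : EReal) + (if P u then (0 : EReal) else ⊤)) - ((⟪η, h⟫ : ℝ) : EReal))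
        * ((‖h‖⁻¹ : ℝ) : EReal) = ⊤ := by
    intro h h0 hP
    simp only [hP, hu, if_true, if_false, add_zero, EReal.coe_add_top, EReal.top_sub_coe]
    exact EReal.top_mul_coe_of_pos (inv_pos.2 (norm_pos_iff.2 h0))
  unfold InFrechetSubdiff
  rw [le_liminf_iff]
  constructor
  · intro H ε hε
    have h1 := H ((-ε : ℝ) : EReal) (by exact_mod_cast neg_lt_zero.2 hε)
    filter_upwards [h1, self_mem_nhdsWithin] with h hh h0 hP
    rw [key h hP, EReal.coe_lt_coe_iff] at hh
    have hn : 0 < ‖h‖ := norm_pos_iff.2 h0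
    rw [← div_eq_mul_inv, lt_div_iff₀ hn] at hh
    linarith
  · intro H y hy
    obtain ⟨c, hyc, hc⟩ := EReal.lt_iff_exists_real_btwn.1 hy
    have hc' : c < 0 := by exact_mod_cast hc
    filter_upwards [H (-c) (by linarith), self_mem_nhdsWithin] with h hh h0
    by_cases hP : P (u + h)
    · rw [key h hP]
      refine hyc.trans_le ?_
      rw [EReal.coe_le_coe_iff, ← div_eq_mul_inv, le_div_iff₀ (norm_pos_iff.2 h0)]
      linarith [hh hP]
    · rw [key' h h0 hP]
      exact hyc.trans (EReal.coe_lt_top c)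

lemma sign_mul_abs_rpow_sub_one {p t : ℝ} (ht : t ≠ 0) :
    Real.sign t * |t| ^ (p - 1) = |t| ^ p / t := by
  have h0 : 0 < |t| := abs_pos.2 ht
  rw [Real.rpow_sub_one h0.ne']
  rcases lt_or_gt_of_ne ht with h | h
  · rw [Real.sign_of_neg h, abs_of_neg h, div_neg]; ring
  · rw [Real.sign_of_pos h, abs_of_pos h]; ring

lemma abs_add_rpow_le {p t h : ℝ} (hp0 : 0 ≤ p) (hp1 : p ≤ 1) (ht : t ≠ 0) (hh : |h| ≤ |t|) :
    |t + h| ^ p ≤ |t| ^ p + p * (Real.sign t * |t| ^ (p - 1)) * h := by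
  have hs : -1 ≤ h / t := by
    have : |h / t| ≤ 1 := by rw [abs_div]; exact div_le_one_of_le₀ hh (abs_nonneg t)
    exact (abs_le.1 this).1
  have e : |t + h| = |t| * (1 + h / t) := by
    rw [← abs_of_nonneg (by linarith : 0 ≤ 1 + h / t), ← abs_mul]
    congr 1; field_simp
  rw [e, Real.mul_rpow (abs_nonneg t) (by linarith), sign_mul_abs_rpow_sub_one ht]
  calc |t| ^ p * (1 + h / t) ^ p ≤ |t| ^ p * (1 + p * (h / t)) :=
        mul_le_mul_of_nonneg_left (rpow_one_add_le_one_add_mul_self hs hp0 hp1)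
          (Real.rpow_nonneg (abs_nonneg t) p)
    _ = _ := by ring

lemma abs_rpow_sub_abs_add_rpow_le {p t : ℝ} (h : ℝ) (hp0 : 0 ≤ p) (hp1 : p ≤ 1) (ht : t ≠ 0) :
    |t| ^ p - |t + h| ^ p ≤ |t| ^ (p - 1) * |h| := by
  have h0 : 0 < |t| := abs_pos.2 ht
  have hc : 0 ≤ |t| ^ (p - 1) := Real.rpow_nonneg h0.le _
  rcases le_total |t| |t + h| with hle | hle
  · have := Real.rpow_le_rpow h0.le hle hp0
    nlinarith [mul_nonneg hc (abs_nonneg h)]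
  · have h1 : |t + h| / |t| ≤ (|t + h| / |t|) ^ p := by
      have := Real.rpow_le_rpow_of_exponent_ge' (x := |t + h| / |t|) (by positivity)
        (div_le_one_of_le₀ hle h0.le) hp0 hp1
      rwa [Real.rpow_one] at this
    rw [Real.div_rpow (abs_nonneg _) h0.le, div_le_div_iff₀ h0 (by positivity)] at h1
    have h2 : |t| ^ p = |t| ^ (p - 1) * |t| := by
      rw [Real.rpow_sub_one h0.ne']; field_simp
    have h3 : |t| ≤ |t + h| + |h| := by
      have := abs_sub (t + h) h
      simpa using this
    rw [h2] at h1 ⊢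
    have h4 : |t| ^ (p - 1) * |t + h| ≤ |t + h| ^ p := by
      have : (|t| ^ (p - 1) * |t + h|) * |t| ≤ |t + h| ^ p * |t| := by linarith
      exact le_of_mul_le_mul_right this h0
    nlinarith [mul_le_mul_of_nonneg_left h3 hc]

lemma hasDerivAt_abs_rpow_of_ne_zero {p t : ℝ} (ht : t ≠ 0) :
    HasDerivAt (fun s : ℝ => |s| ^ p) (p * (Real.sign t * |t| ^ (p - 1))) t := by
  have h1 : HasDerivAt (fun s : ℝ => |s|) (Real.sign t) t := by
    rcases lt_or_gt_of_ne ht with h | h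
    · rw [Real.sign_of_neg h]; exact hasDerivAt_abs_neg h
    · rw [Real.sign_of_pos h]; exact hasDerivAt_abs_pos h
  convert h1.rpow_const (p := p) (Or.inl (abs_pos.2 ht).ne') using 1
  ring

/-- First-order optimality condition at `t` for `s ↦ |s| ^ p - y * s` on `[a, b]`, void at `0`. -/
def RpowStationary (p a b t y : ℝ) : Prop :=
  t ≠ 0 →
    (t = b → p * (Real.sign t * |t| ^ (p - 1)) ≤ y) ∧
    (t = a → y ≤ p * (Real.sign t * |t| ^ (p - 1))) ∧
    (a < t ∧ t < b → y = p * (Real.sign t * |t| ^ (p - 1)))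

lemma RpowStationary.mul_le {p a b t y h : ℝ} (H : RpowStationary p a b t y) (ht : t ≠ 0)
    (hat : a ≤ t) (htb : t ≤ b) (ha : a ≤ t + h) (hb : t + h ≤ b) :
    y * h ≤ p * (Real.sign t * |t| ^ (p - 1)) * h := by
  obtain ⟨h1, h2, h3⟩ := H ht
  rcases hat.eq_or_lt with e | l
  · exact mul_le_mul_of_nonneg_right (h2 e.symm) (by linarith)
  rcases htb.eq_or_lt with e' | l'
  · exact mul_le_mul_of_nonpos_right (h1 e') (by linarith)
  · rw [h3 ⟨l, l'⟩]

lemma RpowStationary.sub_le {p a b t y h : ℝ} (hp0 : 0 < p) (hp1 : p ≤ 1)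
    (H : RpowStationary p a b t y) (hat : a ≤ t) (htb : t ≤ b) (ha : a ≤ t + h)
    (hb : t + h ≤ b) :
    |t| ^ p - |t + h| ^ p + y * h ≤ (1 + p⁻¹) * |y| * |h| := by
  have hyh : y * h ≤ |y| * |h| := by rw [← abs_mul]; exact le_abs_self _
  have hnn : 0 ≤ p⁻¹ * (|y| * |h|) := by positivity
  rcases le_or_gt |t| |t + h| with hle | hlt
  · have := Real.rpow_le_rpow (abs_nonneg t) hle hp0.le
    linarith
  · have ht : t ≠ 0 := by
      rintro rfl
      simp only [abs_zero] at hlt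
      linarith [abs_nonneg (0 + h)]
    have hd := H.mul_le ht hat htb ha hb
    have hpos : 0 < |t| ^ (p - 1) := Real.rpow_pos_of_pos (abs_pos.2 ht) _
    have hy : p * |t| ^ (p - 1) ≤ |y| := by
      rcases lt_or_gt_of_ne ht with h0 | h0
      · have hh : 0 < h := by
          rw [abs_of_neg h0] at hlt
          linarith [neg_abs_le (t + h)]
        rw [Real.sign_of_neg h0] at hd
        have := le_of_mul_le_mul_right hd hh
        linarith [neg_abs_le y]
      · have hh : h < 0 := by
          rw [abs_of_pos h0] at hlt
          linarith [le_abs_self (t + h)]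
        rw [Real.sign_of_pos h0] at hd
        have := (mul_le_mul_right_of_neg hh).1 hd
        linarith [le_abs_self y]
    have h1 := abs_rpow_sub_abs_add_rpow_le h hp0.le hp1 ht
    have h2 : |t| ^ (p - 1) ≤ p⁻¹ * |y| := by
      rw [inv_mul_eq_div, le_div_iff₀ hp0]; linarith
    nlinarith [mul_le_mul_of_nonneg_right h2 (abs_nonneg h)]

lemma RpowStationary.eventually_sub_le {p a b t y : ℝ} (hp0 : 0 < p) (hp1 : p < 1)
    (H : RpowStationary p a b t y) (hat : a ≤ t) (htb : t ≤ b) {ε : ℝ} (hε : 0 < ε) :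
    ∀ᶠ h in 𝓝 (0 : ℝ), a ≤ t + h → t + h ≤ b →
      |t| ^ p - |t + h| ^ p + y * h ≤ ε * |h| := by
  by_cases ht : t = 0
  · subst ht
    have hc : Tendsto (fun h : ℝ => |y| * |h| ^ (1 - p)) (𝓝 0) (𝓝 0) := by
      have : Continuous (fun h : ℝ => |y| * |h| ^ (1 - p)) :=
        continuous_const.mul (continuous_abs.rpow_const fun _ => Or.inr (by linarith))
      have h0 := this.tendsto 0
      simpa [Real.zero_rpow (by linarith : 1 - p ≠ 0)] using h0
    filter_upwards [hc.eventually_lt_const one_pos] with h hh _ _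
    have hyh : y * h ≤ |y| * |h| := by rw [← abs_mul]; exact le_abs_self _
    have e : |h| = |h| ^ (1 - p) * |h| ^ p := by
      rw [← Real.rpow_add_of_nonneg (abs_nonneg h) (by linarith) hp0.le]; simp
    have h1 : |y| * |h| ≤ |h| ^ p := by
      calc |y| * |h| = (|y| * |h| ^ (1 - p)) * |h| ^ p := by rw [mul_assoc, ← e]
        _ ≤ 1 * |h| ^ p := mul_le_mul_of_nonneg_right hh.le (Real.rpow_nonneg (abs_nonneg h) p)
        _ = _ := one_mul _
    rw [abs_zero, Real.zero_rpow hp0.ne', zero_add]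
    have := mul_nonneg hε.le (abs_nonneg h)
    linarith
  · have hd := hasDerivAt_iff_isLittleO_nhds_zero.1 (hasDerivAt_abs_rpow_of_ne_zero (p := p) ht)
    filter_upwards [hd.bound hε] with h hh ha hb
    have h1 := H.mul_le ht hat htb ha hb
    rw [Real.norm_eq_abs, Real.norm_eq_abs, smul_eq_mul] at hh
    have := (abs_le.1 hh).1
    linarith

section LpIntegral

variable {α : Type*} [MeasurableSpace α] {μ : Measure α}

lemma integrable_abs_rpow_of_Lp_two [IsFiniteMeasure μ] {p : ℝ} (hp0 : 0 < p) (hp2 : p ≤ 2)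
    (u : Lp ℝ 2 μ) : Integrable (fun x => |u x| ^ p) μ := by
  have h1 : MemLp u (ENNReal.ofReal p) μ :=
    (Lp.memLp u).mono_exponent (by simpa using ENNReal.ofReal_le_ofReal hp2)
  have h2 := h1.integrable_norm_rpow (by simpa using hp0) ENNReal.ofReal_ne_top
  simpa [ENNReal.toReal_ofReal hp0.le] using h2

lemma integrable_mul_Lp_two (u v : Lp ℝ 2 μ) : Integrable (fun x => u x * v x) μ := by
  have h := L2.integrable_inner (𝕜 := ℝ) v u
  simpa using h

lemma inner_Lp_two_eq_integral_mul (u v : Lp ℝ 2 μ) : ⟪u, v⟫ = ∫ x, u x * v x ∂μ := by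
  rw [real_inner_comm, L2.inner_def]
  simp

variable [IsFiniteMeasure μ] {p : ℝ}

lemma integrable_abs_add_rpow_sub (hp0 : 0 < p) (hp2 : p ≤ 2) (u η h : Lp ℝ 2 μ) :
    Integrable (fun x => |u x + h x| ^ p - |u x| ^ p - η x * h x) μ := by
  have h1 : Integrable (fun x => |u x + h x| ^ p) μ := by
    refine (integrable_abs_rpow_of_Lp_two hp0 hp2 (u + h)).congr ?_
    filter_upwards [Lp.coeFn_add u h] with x hx
    rw [hx, Pi.add_apply]
  exact (h1.sub (integrable_abs_rpow_of_Lp_two hp0 hp2 u)).sub (integrable_mul_Lp_two η h)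

lemma integral_abs_rpow_sub_sub_inner (hp0 : 0 < p) (hp2 : p ≤ 2) (u η h : Lp ℝ 2 μ) :
    (∫ x, |(u + h : Lp ℝ 2 μ) x| ^ p ∂μ) - (∫ x, |u x| ^ p ∂μ) - ⟪η, h⟫ =
      ∫ x, (|u x + h x| ^ p - |u x| ^ p - η x * h x) ∂μ := by
  have h1 := integrable_abs_rpow_of_Lp_two hp0 hp2 (u + h)
  have h2 := integrable_abs_rpow_of_Lp_two hp0 hp2 u
  have h3 := integrable_mul_Lp_two η h
  rw [inner_Lp_two_eq_integral_mul, ← integral_sub h1 h2]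
  have h4 := integral_sub (h1.sub h2) h3
  simp only [Pi.sub_apply] at h4
  rw [← h4]
  refine integral_congr_ae ?_
  filter_upwards [Lp.coeFn_add u h] with x hx
  rw [hx, Pi.add_apply]

lemma eventually_neg_le_of_rpowStationary (hp0 : 0 < p) (hp1 : p < 1) (a b u η : Lp ℝ 2 μ)
    (hu : ∀ᵐ x ∂μ, a x ≤ u x ∧ u x ≤ b x)
    (H : ∀ᵐ x ∂μ, RpowStationary p (a x) (b x) (u x) (η x)) {ε : ℝ} (hε : 0 < ε) :
    ∀ᶠ h in 𝓝[≠] (0 : Lp ℝ 2 μ), (∀ᵐ x ∂μ, a x ≤ (u + h : Lp ℝ 2 μ) x ∧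
      (u + h : Lp ℝ 2 μ) x ≤ b x) →
      -(ε * ‖h‖) ≤ ∫ x, (|u x + h x| ^ p - |u x| ^ p - η x * h x) ∂μ := by
  by_contra hcon
  obtain ⟨s, hs, hbad⟩ := exists_seq_forall_of_frequently (not_eventually.1 hcon)
  have hs0 : Tendsto s atTop (𝓝 0) := hs.mono_right nhdsWithin_le_nhds
  obtain ⟨n, hn, hae⟩ := (tendstoInMeasure_of_tendsto_Lp hs0).exists_seq_tendsto_ae
  set C : ℝ := 1 + p⁻¹
  set r : ℕ → α → ℝ := fun k x => |u x + s (n k) x| ^ p - |u x| ^ p - η x * s (n k) x with hr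
  set ψ : ℕ → α → ℝ := fun k x => max (-(r k x)) 0 / |s (n k) x| with hψ
  have hrint : ∀ k, Integrable (r k) μ := fun k =>
    integrable_abs_add_rpow_sub hp0 (by linarith) u η (s (n k))
  have hadm : ∀ k, ∀ᵐ x ∂μ, a x ≤ u x + s (n k) x ∧ u x + s (n k) x ≤ b x := fun k => by
    have h1 := hbad (n k)
    push Not at h1
    filter_upwards [h1.1, Lp.coeFn_add u (s (n k))] with x hx hx'
    rwa [hx', Pi.add_apply] at hx
  have hψ0 : ∀ k x, 0 ≤ ψ k x := fun k x => by positivity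
  have hψle : ∀ k, ∀ᵐ x ∂μ, ψ k x ≤ C * |η x| := fun k => by
    filter_upwards [hu, H, hadm k] with x hux hHx hax
    have h1 := hHx.sub_le hp0 hp1.le hux.1 hux.2 hax.1 hax.2
    have hC0 : 0 ≤ C * |η x| := by positivity
    refine div_le_of_le_mul₀ (abs_nonneg _) hC0 (max_le ?_ (by positivity))
    simp only [hr]; linarith
  have hψsq : ∀ k, ∀ᵐ x ∂μ, ‖ψ k x ^ 2‖ ≤ C ^ 2 * (η x * η x) := fun k => by
    filter_upwards [hψle k] with x hx
    rw [Real.norm_of_nonneg (by positivity)]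
    calc ψ k x ^ 2 ≤ (C * |η x|) ^ 2 := pow_le_pow_left₀ (hψ0 k x) hx 2
      _ = _ := by rw [mul_pow, sq_abs]; ring
  have hψmeas : ∀ k, AEStronglyMeasurable (fun x => ψ k x ^ 2) μ := fun k => by
    have h1 := (hrint k).aestronglyMeasurable.aemeasurable
    have h2 := (Lp.aestronglyMeasurable (s (n k))).aemeasurable
    exact (((h1.neg.max aemeasurable_const).div h2.abs).pow_const 2).aestronglyMeasurable
  have hbint : Integrable (fun x => C ^ 2 * (η x * η x)) μ :=
    (integrable_mul_Lp_two η η).const_mul _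
  have hlim : Tendsto (fun k => ∫ x, ψ k x ^ 2 ∂μ) atTop (𝓝 (∫ _, (0 : ℝ) ∂μ)) := by
    refine tendsto_integral_of_dominated_convergence _ hψmeas hbint hψsq ?_
    filter_upwards [hu, H, ae_all_iff.2 hadm, hae, Lp.coeFn_zero ℝ 2 μ] with x hux hHx hax hx h0
    rw [h0, Pi.zero_apply] at hx
    have hψx : Tendsto (fun k => ψ k x) atTop (𝓝 0) := by
      refine tendsto_order.2 ⟨fun c hc => Eventually.of_forall fun k => hc.trans_le (hψ0 k x),
        fun c hc => ?_⟩
      filter_upwards [hx.eventually (hHx.eventually_sub_le hp0 hp1 hux.1 hux.2 (half_pos hc))]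
        with k hk
      have h1 := hk (hax k).1 (hax k).2
      refine (div_le_of_le_mul₀ (abs_nonneg _) (half_pos hc).le
        (max_le ?_ (by positivity))).trans_lt (half_lt_self hc)
      simp only [hr]; linarith
    simpa using hψx.pow 2
  rw [integral_zero] at hlim
  obtain ⟨k, hk⟩ := (hlim.eventually_lt_const (show (0 : ℝ) < ε ^ 2 by positivity)).exists
  have hb := hbad (n k)
  push Not at hb
  have hN : 0 < ‖s (n k)‖ := by
    by_contra h0
    have h1 : ‖s (n k)‖ = 0 := le_antisymm (not_lt.1 h0) (norm_nonneg _)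
    have h2 : s (n k) = 0 := norm_eq_zero.1 h1
    have h3 := hb.2
    rw [h1, ← integral_abs_rpow_sub_sub_inner hp0 (by linarith), h2] at h3
    simp at h3
  set N := ‖s (n k)‖ with hNdef
  have hψint : Integrable (fun x => ψ k x ^ 2) μ := hbint.mono' (hψmeas k) (hψsq k)
  have hsint := integrable_mul_Lp_two (s (n k)) (s (n k))
  have hint : Integrable (fun x => -(N / (2 * ε) * ψ k x ^ 2 +
      ε / (2 * N) * (s (n k) x * s (n k) x))) μ :=
    ((hψint.const_mul _).add (hsint.const_mul _)).neg
  have hmono : ∫ x, -(N / (2 * ε) * ψ k x ^ 2 + ε / (2 * N) * (s (n k) x * s (n k) x)) ∂μ ≤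
      ∫ x, r k x ∂μ := by
    refine integral_mono hint (hrint k) fun x => ?_
    have h1 : -(r k x) ≤ ψ k x * |s (n k) x| := by
      by_cases h0 : s (n k) x = 0
      · simp [hr, h0]
      · rw [hψ, div_mul_cancel₀ _ (abs_pos.2 h0).ne']
        exact le_max_left _ _
    have h2 : ψ k x * |s (n k) x| ≤ N / (2 * ε) * ψ k x ^ 2 +
        ε / (2 * N) * (s (n k) x * s (n k) x) := by
      rw [← abs_mul_abs_self (s (n k) x)]
      have : N / (2 * ε) * ψ k x ^ 2 + ε / (2 * N) * (|s (n k) x| * |s (n k) x|) -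
          ψ k x * |s (n k) x| = (N * ψ k x - ε * |s (n k) x|) ^ 2 / (2 * ε * N) := by
        field_simp; ring
      have h3 : 0 ≤ (N * ψ k x - ε * |s (n k) x|) ^ 2 / (2 * ε * N) := by positivity
      linarith
    simp only
    linarith
  rw [integral_neg, integral_add (hψint.const_mul _) (hsint.const_mul _), integral_const_mul,
    integral_const_mul, ← inner_Lp_two_eq_integral_mul, real_inner_self_eq_norm_sq,
    ← hNdef] at hmono
  have h1 : N / (2 * ε) * ∫ x, ψ k x ^ 2 ∂μ < N / (2 * ε) * ε ^ 2 :=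
    mul_lt_mul_of_pos_left hk (by positivity)
  have h2 : N / (2 * ε) * ε ^ 2 = ε * N / 2 := by field_simp
  have h3 : ε / (2 * N) * N ^ 2 = ε * N / 2 := by field_simp
  linarith [hb.2]

lemma measure_eq_zero_of_forall_eventually_neg_le (hp0 : 0 < p) (hp1 : p < 1)
    (a b u η : Lp ℝ 2 μ) (hu : ∀ᵐ x ∂μ, a x ≤ u x ∧ u x ≤ b x)
    (H : ∀ ε > 0, ∀ᶠ h in 𝓝[≠] (0 : Lp ℝ 2 μ), (∀ᵐ x ∂μ, a x ≤ (u + h : Lp ℝ 2 μ) x ∧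
      (u + h : Lp ℝ 2 μ) x ≤ b x) →
      -(ε * ‖h‖) ≤ ∫ x, (|u x + h x| ^ p - |u x| ^ p - η x * h x) ∂μ)
    {σ δ : ℝ} (hσ : |σ| = 1) (hδ : 0 < δ) {B : Set α} (hB : MeasurableSet B)
    (hB0 : ∀ x ∈ B, u x ≠ 0 ∧ δ ≤ |u x|) (hBa : ∀ x ∈ B, a x ≤ u x + δ * σ)
    (hBb : ∀ x ∈ B, u x + δ * σ ≤ b x)
    (hBd : ∀ x ∈ B, (p * (Real.sign (u x) * |u x| ^ (p - 1)) - η x) * σ ≤ -δ) :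
    μ B = 0 := by
  have hBtop : μ B ≠ ⊤ := measure_ne_top μ B
  by_contra hμB
  set v : Lp ℝ 2 μ := indicatorConstLp 2 hB hBtop σ
  have hvx : ∀ᵐ x ∂μ, v x = B.indicator (fun _ => σ) x := indicatorConstLp_coeFn
  have hσ0 : σ ≠ 0 := by rintro rfl; simp at hσ
  have hv0 : v ≠ 0 := by
    intro h0
    have h1 := hvx
    rw [h0] at h1
    refine hμB (measure_eq_zero_iff_ae_notMem.2 ?_)
    filter_upwards [h1, Lp.coeFn_zero ℝ 2 μ] with x hx hx0 hxB
    rw [hx0, Set.indicator_of_mem hxB] at hx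
    exact hσ0 hx.symm
  have hm : 0 < μ.real B := ENNReal.toReal_pos hμB hBtop
  have hvn : 0 < ‖v‖ := norm_pos_iff.2 hv0
  set ε := δ * μ.real B / (2 * ‖v‖) with hε
  have htend : Tendsto (fun t : ℝ => t • v) (𝓝[>] 0) (𝓝[≠] 0) := by
    refine tendsto_nhdsWithin_iff.2 ⟨?_, ?_⟩
    · have : Continuous (fun t : ℝ => t • v) := by fun_prop
      simpa using (this.tendsto 0).mono_left nhdsWithin_le_nhds
    · filter_upwards [self_mem_nhdsWithin] with t ht
      exact smul_ne_zero (ne_of_gt ht) hv0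
  obtain ⟨t, hHt, ht⟩ := ((htend.eventually (H ε (by positivity))).and
    (Ioo_mem_nhdsGT hδ)).exists
  have htx : ∀ᵐ x ∂μ, (t • v) x = B.indicator (fun _ => t * σ) x := by
    filter_upwards [hvx, Lp.coeFn_smul t v] with x hx hx'
    rw [hx', Pi.smul_apply, hx, smul_eq_mul]
    by_cases hxB : x ∈ B <;> simp [hxB]
  have hge := hHt (by
    filter_upwards [htx, Lp.coeFn_add u (t • v), hu] with x hx hx' hux
    rw [hx', Pi.add_apply, hx]
    by_cases hxB : x ∈ B
    · rw [Set.indicator_of_mem hxB]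
      have h1 := hBa x hxB
      have h2 := hBb x hxB
      rcases le_total 0 σ with hs | hs
      · have h3 := mul_le_mul_of_nonneg_right ht.2.le hs
        have h4 := mul_nonneg ht.1.le hs
        constructor <;> linarith [hux.1, hux.2]
      · have h3 := mul_le_mul_of_nonpos_right ht.2.le hs
        have h4 := mul_nonpos_of_nonneg_of_nonpos ht.1.le hs
        constructor <;> linarith [hux.1, hux.2]
    · rw [Set.indicator_of_notMem hxB, add_zero]; exact hux)
  have hle : ∫ x, (|u x + (t • v) x| ^ p - |u x| ^ p - η x * (t • v) x) ∂μ ≤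
      ∫ x, B.indicator (fun _ => -(t * δ)) x ∂μ := by
    refine integral_mono_ae (integrable_abs_add_rpow_sub hp0 (by linarith) u η (t • v))
      ((integrable_const _).indicator hB) ?_
    filter_upwards [htx] with x hx
    rw [hx]
    by_cases hxB : x ∈ B
    · simp only [Set.indicator_of_mem hxB]
      have h1 : |t * σ| ≤ |u x| := by
        rw [abs_mul, hσ, mul_one, abs_of_pos ht.1]
        exact ht.2.le.trans (hB0 x hxB).2
      have h2 := abs_add_rpow_le hp0.le hp1.le (hB0 x hxB).1 h1
      have h3 := mul_le_mul_of_nonneg_left (hBd x hxB) ht.1.le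
      linarith
    · simp [hxB]
  rw [integral_indicator_const _ hB, smul_eq_mul] at hle
  have h5 : ε * ‖t • v‖ = t * (δ * μ.real B) / 2 := by
    rw [norm_smul, Real.norm_of_nonneg ht.1.le, hε]; field_simp
  rw [h5] at hge
  have h6 : 0 < t * (δ * μ.real B) := mul_pos ht.1 (mul_pos hδ hm)
  linarith

lemma ae_le_mul_of_forall_eventually_neg_le (hp0 : 0 < p) (hp1 : p < 1)
    (a b u η : Lp ℝ 2 μ) (hu : ∀ᵐ x ∂μ, a x ≤ u x ∧ u x ≤ b x)
    (H : ∀ ε > 0, ∀ᶠ h in 𝓝[≠] (0 : Lp ℝ 2 μ), (∀ᵐ x ∂μ, a x ≤ (u + h : Lp ℝ 2 μ) x ∧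
      (u + h : Lp ℝ 2 μ) x ≤ b x) →
      -(ε * ‖h‖) ≤ ∫ x, (|u x + h x| ^ p - |u x| ^ p - η x * h x) ∂μ)
    {σ : ℝ} (hσ : |σ| = 1) :
    ∀ᵐ x ∂μ, u x ≠ 0 → (∃ δ > 0, a x ≤ u x + δ * σ ∧ u x + δ * σ ≤ b x) →
      0 ≤ (p * (Real.sign (u x) * |u x| ^ (p - 1)) - η x) * σ := by
  have hum : Measurable u := (Lp.stronglyMeasurable u).measurable
  have hηm : Measurable η := (Lp.stronglyMeasurable η).measurable
  have ham : Measurable a := (Lp.stronglyMeasurable a).measurable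
  have hbm : Measurable b := (Lp.stronglyMeasurable b).measurable
  have hsign : Measurable Real.sign := by
    unfold Real.sign
    exact Measurable.ite measurableSet_Iio measurable_const
      (Measurable.ite measurableSet_Ioi measurable_const measurable_const)
  set B : ℕ → Set α := fun n => {x | (1 / ((n : ℝ) + 1) ≤ |u x|) ∧
    (a x ≤ u x + 1 / ((n : ℝ) + 1) * σ) ∧ (u x + 1 / ((n : ℝ) + 1) * σ ≤ b x) ∧
    ((p * (Real.sign (u x) * |u x| ^ (p - 1)) - η x) * σ ≤ -(1 / ((n : ℝ) + 1)))}
  have hBm : ∀ n, MeasurableSet (B n) := fun n => by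
    have hus : Measurable fun x => u x + 1 / ((n : ℝ) + 1) * σ := hum.add_const _
    have hd : Measurable fun x => (p * (Real.sign (u x) * |u x| ^ (p - 1)) - η x) * σ :=
      ((((hsign.comp hum).mul (hum.abs.pow_const _)).const_mul p).sub hηm).mul_const σ
    exact (measurableSet_le measurable_const hum.abs).inter
      ((measurableSet_le ham hus).inter ((measurableSet_le hus hbm).inter
        (measurableSet_le hd measurable_const)))
  have hB0 : ∀ n, ∀ᵐ x ∂μ, x ∉ B n := fun n => by
    have hn : 0 < 1 / ((n : ℝ) + 1) := Nat.one_div_pos_of_nat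
    refine measure_eq_zero_iff_ae_notMem.1 (measure_eq_zero_of_forall_eventually_neg_le
      hp0 hp1 a b u η hu H hσ hn (hBm n) (fun x hx => ⟨?_, hx.1⟩) (fun x hx => hx.2.1)
      (fun x hx => hx.2.2.1) fun x hx => hx.2.2.2)
    exact abs_pos.1 (hn.trans_le hx.1)
  filter_upwards [ae_all_iff.2 hB0, hu] with x hx hux hx0 hδ
  obtain ⟨δ, hδ0, hδa, hδb⟩ := hδ
  by_contra hneg
  push Not at hneg
  obtain ⟨n, hn⟩ := exists_nat_one_div_lt
    (lt_min (abs_pos.2 hx0) (lt_min hδ0 (neg_pos.2 hneg)))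
  have h0 : 0 < 1 / ((n : ℝ) + 1) := Nat.one_div_pos_of_nat
  obtain ⟨hn1, hn2, hn3⟩ := by simpa only [lt_min_iff] using hn
  refine hx n ⟨hn1.le, ?_, ?_, by linarith⟩
  · rcases le_total 0 σ with hs | hs
    · linarith [mul_nonneg h0.le hs, hux.1]
    · linarith [mul_le_mul_of_nonpos_right hn2.le hs]
  · rcases le_total 0 σ with hs | hs
    · linarith [mul_le_mul_of_nonneg_right hn2.le hs]
    · linarith [mul_nonpos_of_nonneg_of_nonpos h0.le hs, hux.2]

lemma ae_rpowStationary_of_forall_eventually_neg_le (hp0 : 0 < p) (hp1 : p < 1)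
    (a b u η : Lp ℝ 2 μ) (hab : ∀ᵐ x ∂μ, a x < b x) (hu : ∀ᵐ x ∂μ, a x ≤ u x ∧ u x ≤ b x)
    (H : ∀ ε > 0, ∀ᶠ h in 𝓝[≠] (0 : Lp ℝ 2 μ), (∀ᵐ x ∂μ, a x ≤ (u + h : Lp ℝ 2 μ) x ∧
      (u + h : Lp ℝ 2 μ) x ≤ b x) →
      -(ε * ‖h‖) ≤ ∫ x, (|u x + h x| ^ p - |u x| ^ p - η x * h x) ∂μ) :
    ∀ᵐ x ∂μ, RpowStationary p (a x) (b x) (u x) (η x) := by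
  filter_upwards [hab, hu,
    ae_le_mul_of_forall_eventually_neg_le hp0 hp1 a b u η hu H (σ := 1) (by simp),
    ae_le_mul_of_forall_eventually_neg_le hp0 hp1 a b u η hu H (σ := -1) (by simp)]
    with x habx hux hpos hneg hx0
  have h1 : u x < b x → η x ≤ p * (Real.sign (u x) * |u x| ^ (p - 1)) := fun h => by
    have := hpos hx0 ⟨b x - u x, by linarith, by linarith, by linarith⟩
    linarith
  have h2 : a x < u x → p * (Real.sign (u x) * |u x| ^ (p - 1)) ≤ η x := fun h => by
    have := hneg hx0 ⟨u x - a x, by linarith, by linarith, by linarith⟩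
    linarith
  exact ⟨fun h => h2 (h ▸ habx), fun h => h1 (h ▸ habx), fun h => le_antisymm (h1 h.2) (h2 h.1)⟩

end LpIntegral

/-- characterization of the Fréchet subdifferential of
`j + I_{U_ad}` (with `j(u) = ∫_Ω |u|^p dx` and `U_ad = {a ≤ u ≤ b}`) at `ū ∈ U_ad`:
`η ∈ ∂̂(j + I_{U_ad})(ū)` iff `η ≥ p|ū|^{p−2}ū` a.e. on `{ū = b} ∩ {ū ≠ 0}`,
`η ≤ p|ū|^{p−2}ū` a.e. on `{ū = a} ∩ {ū ≠ 0}` and `η = p|ū|^{p−2}ū` a.e. on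
`{a < ū < b} ∩ {ū ≠ 0}` (where `|ū|^{p−2}ū = sign(ū)·|ū|^{p−1}`). -/
theorem frechet_subdiff_characterization
    {d : ℕ} (hd : 1 ≤ d) (Ω : Set (EuclideanSpace ℝ (Fin d)))
    (hΩ_open : IsOpen Ω) (hΩ_conn : IsConnected Ω) (hΩ_bdd : Bornology.IsBounded Ω)
    (p : ℝ) (hp0 : 0 < p) (hp1 : p < 1)
    (a b ubar η : Lp ℝ 2 (volume.restrict Ω))
    (hab : ∀ᵐ x ∂(volume.restrict Ω), a x < b x)
    (hubar : ∀ᵐ x ∂(volume.restrict Ω), a x ≤ ubar x ∧ ubar x ≤ b x) :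
    InFrechetSubdiff
      (fun u : Lp ℝ 2 (volume.restrict Ω) =>
        ((∫ x, |u x| ^ p ∂(volume.restrict Ω) : ℝ) : EReal) +
          (if ∀ᵐ x ∂(volume.restrict Ω), a x ≤ u x ∧ u x ≤ b x then (0 : EReal) else ⊤))
      ubar η ↔
    (∀ᵐ x ∂(volume.restrict Ω), ubar x ≠ 0 →
      (ubar x = b x → p * (Real.sign (ubar x) * |ubar x| ^ (p - 1)) ≤ η x) ∧
      (ubar x = a x → η x ≤ p * (Real.sign (ubar x) * |ubar x| ^ (p - 1))) ∧
      (a x < ubar x ∧ ubar x < b x →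
        η x = p * (Real.sign (ubar x) * |ubar x| ^ (p - 1)))) := by
  have : IsFiniteMeasure (volume.restrict Ω) := ⟨by
    rw [Measure.restrict_apply_univ]; exact hΩ_bdd.measure_lt_top⟩
  rw [inFrechetSubdiff_add_indicator_iff
    (fun u : Lp ℝ 2 (volume.restrict Ω) => ∫ x, |u x| ^ p ∂(volume.restrict Ω))
    (fun u => ∀ᵐ x ∂(volume.restrict Ω), a x ≤ u x ∧ u x ≤ b x) ubar η hubar]
  simp only [integral_abs_rpow_sub_sub_inner hp0 (hp1.le.trans one_le_two)]
  exact ⟨ae_rpowStationary_of_forall_eventually_neg_le hp0 hp1 a b ubar η hab hubar,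
    fun H _ hε => eventually_neg_le_of_rpowStationary hp0 hp1 a b ubar η hubar H hε⟩
end

section
/- Let Ω ⊂ ℝ^d (d ≥ 1) be a bounded domain, p ∈ (0,1), ε > 0, β > 0, α ≥ 0, r > 0 and u, g ∈ L²(Ω). Let v be any global minimizer over L²(Ω) of w ↦ (1/(2r))‖w − (u − r·g)‖²_{L²} + β∫_Ω ψ_ε(w(x)²) dx + (α/2)‖w‖²_{L²}, and let w* be the unique global minimizer over L²(Ω) of w ↦ (1/(2r))‖w − (u − r·g)‖²_{L²} + β∫_Ω [ψ_ε(u(x)²) + ψ_ε'(u(x)²)(w(x)² − u(x)²)] dx + (α/2)‖w‖²_{L²} (the convexified functional at u). Then ‖w* − u‖_{L²(Ω)} ≤ (4 + 2/p)·‖v − u‖_{L²(Ω)}. -/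
open MeasureTheory Filter Topology

/-- The smooth approximation `ψ_ε` of `t ↦ t^{p/2}`:
`ψ_ε(t) = (p/2)·t/ε^{2−p} + (1 − p/2)·ε^p` for `0 ≤ t < ε²` and `ψ_ε(t) = t^{p/2}` for
`t ≥ ε²` (so `ψ_0(t) = t^{p/2}`). Exponents are real powers. -/
noncomputable def psi (p ε t : ℝ) : ℝ :=
  if t < ε ^ 2 then p / 2 * t / ε ^ (2 - p) + (1 - p / 2) * ε ^ p
  else t ^ (p / 2)

/-- The derivative `ψ_ε'(t) = (p/2)·min(ε^{p−2}, t^{(p−2)/2})` of `ψ_ε` (for `ε > 0`);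
since `t^{(p−2)/2} ≥ ε^{p−2}` precisely for `0 ≤ t ≤ ε²`, the minimum is the first
entry on `[0, ε²)` and the second one on `[ε², ∞)`. -/
noncomputable def psiDeriv (p ε t : ℝ) : ℝ :=
  if t < ε ^ 2 then p / 2 * ε ^ (p - 2) else p / 2 * t ^ ((p - 2) / 2)

/-- Bernoulli's inequality as a tangent-line bound for the concave power `t ↦ t ^ q`. -/
theorem rpow_le_tangent {q c s : ℝ} (hq0 : 0 ≤ q) (hq1 : q ≤ 1) (hc : 0 < c) (hs : 0 ≤ s) :
    s ^ q ≤ c ^ q + q * c ^ (q - 1) * (s - c) := by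
  have h := rpow_one_add_le_one_add_mul_self (s := s / c - 1)
    (by linarith [div_nonneg hs hc.le]) hq0 hq1
  rw [add_sub_cancel, Real.div_rpow hs hc.le, div_le_iff₀ (Real.rpow_pos_of_pos hc q)] at h
  rw [Real.rpow_sub_one hc.ne']
  refine h.trans_eq ?_
  field_simp

theorem sq_rpow {ε : ℝ} (hε : 0 < ε) (y : ℝ) : (ε ^ 2) ^ y = ε ^ (2 * y) := by
  rw [Real.rpow_mul hε.le, Real.rpow_two]

theorem psiDeriv_eq_max {p ε : ℝ} (hε : 0 < ε) (t : ℝ) :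
    psiDeriv p ε t = p / 2 * (max t (ε ^ 2)) ^ (p / 2 - 1) := by
  unfold psiDeriv
  split_ifs with h
  · rw [max_eq_right h.le, sq_rpow hε]
    ring_nf
  · rw [max_eq_left (not_lt.mp h)]
    ring_nf

theorem psi_of_le {p ε t : ℝ} (hε : 0 < ε) (ht : t ≤ ε ^ 2) :
    psi p ε t = (ε ^ 2) ^ (p / 2) + p / 2 * (ε ^ 2) ^ (p / 2 - 1) * (t - ε ^ 2) := by
  unfold psi
  split_ifs with h
  · have h1 : 2 * (p / 2 - 1) = -(2 - p) := by ring
    have h2 : 2 * (p / 2) = p := by ring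
    have h3 : ε ^ p = (ε ^ (2 - p))⁻¹ * ε ^ 2 := by
      rw [← Real.rpow_neg hε.le, ← Real.rpow_two, ← Real.rpow_add hε]
      ring_nf
    rw [sq_rpow hε, sq_rpow hε, h1, h2, Real.rpow_neg hε.le, h3]
    ring
  · rw [le_antisymm ht (not_lt.mp h)]
    ring

theorem psi_of_ge {p ε t : ℝ} (ht : ε ^ 2 ≤ t) : psi p ε t = t ^ (p / 2) :=
  if_neg (not_lt.mpr ht)

theorem continuous_psi {p ε : ℝ} (hp : 0 < p) (hε : 0 < ε) : Continuous (psi p ε) := by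
  have h : psi p ε = fun t =>
      p / 2 * (ε ^ 2) ^ (p / 2 - 1) * (min t (ε ^ 2) - ε ^ 2) + (max t (ε ^ 2)) ^ (p / 2) := by
    funext t
    rcases le_total t (ε ^ 2) with ht | ht
    · rw [psi_of_le hε ht, min_eq_left ht, max_eq_right ht]
      ring
    · rw [psi_of_ge ht, min_eq_right ht, max_eq_left ht]
      ring
  rw [h]
  refine Continuous.add (by fun_prop) ?_
  exact (continuous_id.max continuous_const).rpow_const fun _ => Or.inr (by positivity)

theorem continuous_psiDeriv {p ε : ℝ} (hε : 0 < ε) : Continuous (psiDeriv p ε) := by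
  rw [funext (psiDeriv_eq_max (p := p) hε)]
  refine continuous_const.mul ?_
  exact (continuous_id.max continuous_const).rpow_const fun t =>
    Or.inl (lt_of_lt_of_le (by positivity) (le_max_right t (ε ^ 2))).ne'

theorem psiDeriv_pos {p ε : ℝ} (hp : 0 < p) (hε : 0 < ε) (t : ℝ) : 0 < psiDeriv p ε t := by
  rw [psiDeriv_eq_max hε]
  have : 0 < max t (ε ^ 2) := lt_of_lt_of_le (by positivity) (le_max_right _ _)
  positivity

theorem antitone_psiDeriv {p ε : ℝ} (hp : 0 < p) (hp1 : p < 1) (hε : 0 < ε) :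
    Antitone (psiDeriv p ε) := by
  intro s t hst
  rw [psiDeriv_eq_max hε, psiDeriv_eq_max hε]
  have : 0 < max s (ε ^ 2) := lt_of_lt_of_le (by positivity) (le_max_right _ _)
  exact mul_le_mul_of_nonneg_left
    (Real.rpow_le_rpow_of_nonpos this (max_le_max_right _ hst) (by linarith)) (by positivity)

theorem psiDeriv_mul_le {p ε s t : ℝ} (hp : 0 < p) (hε : 0 < ε)
    (hst : s ≤ t) : psiDeriv p ε s * s ≤ psiDeriv p ε t * t := by
  have hc : 0 < ε ^ 2 := by positivity
  rcases le_total t (ε ^ 2) with ht | ht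
  · rw [psiDeriv_eq_max hε, psiDeriv_eq_max hε, max_eq_right ht, max_eq_right (hst.trans ht)]
    exact mul_le_mul_of_nonneg_left hst (by positivity)
  · have ht0 : 0 < t := hc.trans_le ht
    have hm : 0 < max s (ε ^ 2) := hc.trans_le (le_max_right _ _)
    calc psiDeriv p ε s * s ≤ psiDeriv p ε s * max s (ε ^ 2) :=
          mul_le_mul_of_nonneg_left (le_max_left _ _) (psiDeriv_pos hp hε s).le
      _ = p / 2 * (max s (ε ^ 2)) ^ (p / 2) := by
          rw [psiDeriv_eq_max hε, Real.rpow_sub_one hm.ne']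
          field_simp
      _ ≤ p / 2 * t ^ (p / 2) := by
          gcongr
          exact max_le hst ht
      _ = psiDeriv p ε t * t := by
          rw [psiDeriv_eq_max hε, max_eq_left ht, Real.rpow_sub_one ht0.ne']
          field_simp

/-- `psi` is concave on `[0, ∞)`, with `psiDeriv` as supergradient. -/
theorem psi_le_tangent {p ε s t : ℝ} (hp : 0 < p) (hp1 : p < 1) (hε : 0 < ε)
    (hs : 0 ≤ s) : psi p ε s ≤ psi p ε t + psiDeriv p ε t * (s - t) := by
  have hc : 0 < ε ^ 2 := by positivity
  rw [psiDeriv_eq_max hε]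
  rcases le_total s (ε ^ 2) with h1 | h1 <;> rcases le_total t (ε ^ 2) with h2 | h2
  · rw [psi_of_le hε h1, psi_of_le hε h2, max_eq_right h2]
    linarith
  · rw [psi_of_le hε h1, psi_of_ge h2, max_eq_left h2]
    have h3 := rpow_le_tangent (q := p / 2) (by linarith) (by linarith) (hc.trans_le h2) hc.le
    have h4 : t ^ (p / 2 - 1) ≤ (ε ^ 2) ^ (p / 2 - 1) :=
      Real.rpow_le_rpow_of_nonpos hc h2 (by linarith)
    have h5 := mul_le_mul_of_nonneg_left h4 (mul_nonneg hp.le (sub_nonneg.mpr h1))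
    linarith
  · rw [psi_of_ge h1, psi_of_le hε h2, max_eq_right h2]
    have h3 := rpow_le_tangent (q := p / 2) (by linarith) (by linarith) hc hs
    linarith
  · rw [psi_of_ge h1, psi_of_ge h2, max_eq_left h2]
    exact rpow_le_tangent (by linarith) (by linarith) (hc.trans_le h2) hs

theorem rpow_le_psi {p ε t : ℝ} (hp : 0 < p) (hp1 : p < 1) (hε : 0 < ε) (ht : 0 ≤ t) :
    t ^ (p / 2) ≤ psi p ε t := by
  rcases le_total t (ε ^ 2) with h | h
  · rw [psi_of_le hε h]
    exact rpow_le_tangent (by linarith) (by linarith) (by positivity) ht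
  · rw [psi_of_ge h]

theorem psi_nonneg {p ε t : ℝ} (hp : 0 < p) (hp1 : p < 1) (hε : 0 < ε) (ht : 0 ≤ t) :
    0 ≤ psi p ε t :=
  (Real.rpow_nonneg ht _).trans (rpow_le_psi hp hp1 hε ht)

/-- A quadratic lower bound for the concave power at a smaller argument. -/
theorem rpow_sub_rpow_le {p y v : ℝ} (hp : 0 < p) (hp1 : p < 1) (hv : 0 ≤ v) (hvy : v < y) :
    y ^ p - v ^ p ≤ y ^ (p - 2) * (p * y * (y - v) + (1 - p) * (y - v) ^ 2) := by
  have hy : 0 < y := hv.trans_lt hvy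
  have hd : 0 < v + p * (y - v) := by nlinarith
  have hQ : 0 < y ^ (p - 2) := Real.rpow_pos_of_pos hy _
  have hyp : y ^ p = y ^ (p - 2) * y ^ 2 := by
    rw [← Real.rpow_two, ← Real.rpow_add hy]
    ring_nf
  have hlow : y ^ p * v ≤ v ^ p * (v + p * (y - v)) := by
    rcases hv.eq_or_lt with rfl | hv0
    · simp [Real.zero_rpow hp.ne']
    · have h := mul_le_mul_of_nonneg_right (rpow_le_tangent hp.le hp1.le hv0 hy.le) hv
      rw [Real.rpow_sub_one hv0.ne'] at h
      refine h.trans_eq ?_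
      field_simp
  refine le_of_mul_le_mul_right ?_ hd
  have hpoly : y ^ 2 * (p * (y - v)) ≤
      (p * y * (y - v) + (1 - p) * (y - v) ^ 2) * (v + p * (y - v)) := by
    have : 0 ≤ (1 - p) ^ 2 * (y - v) ^ 2 * v := by positivity
    nlinarith
  have := mul_le_mul_of_nonneg_left hpoly hQ.le
  rw [hyp] at hlow ⊢
  nlinarith

theorem psi_sq_sub_le {p ε y v : ℝ} (hp : 0 < p) (hp1 : p < 1) (hε : 0 < ε)
    (hv : 0 ≤ v) (hvy : v < y) :
    psi p ε (y ^ 2) - psi p ε (v ^ 2) ≤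
      psiDeriv p ε (y ^ 2) * (2 * y * (y - v) + 2 * ((1 - p) / p) * (y - v) ^ 2) := by
  have hy : 0 < y := hv.trans_lt hvy
  have hvy2 : v ^ 2 ≤ y ^ 2 := by gcongr
  rcases le_total (y ^ 2) (ε ^ 2) with h | h
  · rw [psi_of_le hε h, psi_of_le hε (hvy2.trans h), psiDeriv_eq_max hε, max_eq_right h]
    have hA : 0 < p / 2 * (ε ^ 2) ^ (p / 2 - 1) := by positivity
    have hB : 0 ≤ (1 - p) / p := div_nonneg (by linarith) hp.le
    have : y ^ 2 - v ^ 2 ≤ 2 * y * (y - v) + 2 * ((1 - p) / p) * (y - v) ^ 2 := by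
      have : 0 ≤ (1 - p) / p * (y - v) ^ 2 := by positivity
      nlinarith [sq_nonneg (y - v)]
    have := mul_le_mul_of_nonneg_left this hA.le
    linarith
  · have h1 := rpow_le_psi hp hp1 hε (sq_nonneg v)
    have h2 := rpow_sub_rpow_le hp hp1 hv hvy
    have hvp : (v ^ 2) ^ (p / 2) = v ^ p := by
      rw [← Real.rpow_two, ← Real.rpow_mul hv]
      ring_nf
    have e1 : 2 * (p / 2) = p := by ring
    have e2 : 2 * (p / 2 - 1) = p - 2 := by ring
    rw [psi_of_ge h, psiDeriv_eq_max hε, max_eq_left h, sq_rpow hy, sq_rpow hy, e1, e2]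
    rw [hvp] at h1
    refine (sub_le_sub_left h1 _).trans (h2.trans_eq ?_)
    field_simp

/-- First-order optimality for a quadratic function of one real variable. -/
theorem eq_zero_of_forall_quadratic_nonneg {A b : ℝ} (hA : 0 < A)
    (h : ∀ s : ℝ, 0 ≤ A * s ^ 2 + b * s) : b = 0 := by
  have h1 := h (-b / (2 * A))
  have h2 : A * (-b / (2 * A)) ^ 2 + b * (-b / (2 * A)) = -(b ^ 2 / (4 * A)) := by
    field_simp
    ring
  rw [h2] at h1
  have h3 : b ^ 2 / (4 * A) ≤ 0 := by linarith
  rw [div_le_iff₀ (by positivity)] at h3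
  exact pow_eq_zero_iff two_ne_zero |>.mp (le_antisymm (by linarith) (sq_nonneg b))

theorem stationary_of_quadratic_min {r α m z w : ℝ} (hr : 0 < r) (hα : 0 ≤ α) (hm : 0 ≤ m)
    (h : ∀ s : ℝ, 1 / (2 * r) * (w - z) ^ 2 + m * w ^ 2 + α / 2 * w ^ 2 ≤
      1 / (2 * r) * (s - z) ^ 2 + m * s ^ 2 + α / 2 * s ^ 2) :
    (1 / r + α + 2 * m) * w = z / r := by
  have := eq_zero_of_forall_quadratic_nonneg (A := 1 / (2 * r) + m + α / 2)
    (b := (1 / r + α + 2 * m) * w - z / r) (by positivity) fun s => by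
      have h1 := h (w + s)
      have h2 : (1 / (2 * r) + m + α / 2) * s ^ 2 + ((1 / r + α + 2 * m) * w - z / r) * s =
          (1 / (2 * r) * (w + s - z) ^ 2 + m * (w + s) ^ 2 + α / 2 * (w + s) ^ 2) -
          (1 / (2 * r) * (w - z) ^ 2 + m * w ^ 2 + α / 2 * w ^ 2) := by
        field_simp
        ring
      linarith
  linarith

/-- The scalar comparison for a nonnegative stationary point `v` satisfying the global
minimality inequality `hmin`. -/
theorem stationary_distance_of_nonneg {p ε β a u v w : ℝ} (hp : 0 < p) (hp1 : p < 1)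
    (hε : 0 < ε) (hβ : 0 < β) (ha : 0 < a) (hv : 0 ≤ v)
    (hw : (a + 2 * β * psiDeriv p ε (u ^ 2)) * w = (a + 2 * β * psiDeriv p ε (v ^ 2)) * v)
    (hmin : ∀ s : ℝ, 2 * β * psiDeriv p ε (v ^ 2) * v * (s - v) ≤
      a / 2 * (s - v) ^ 2 + β * (psi p ε (s ^ 2) - psi p ε (v ^ 2))) :
    |w - u| ≤ (4 + 2 / p) * |v - u| := by
  set P := 2 * β * psiDeriv p ε (u ^ 2) with hP
  set N := 2 * β * psiDeriv p ε (v ^ 2) with hN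
  have hP0 : 0 < P := mul_pos (by positivity) (psiDeriv_pos hp hε _)
  have hC : 0 < 1 / p := by positivity
  have hK : 4 + 2 / p = 4 + 2 * (1 / p) := by ring
  have hPa : 0 < a + P := by positivity
  suffices h : |(a + N) * v - (a + P) * u| ≤ (4 + 2 / p) * ((a + P) * |v - u|) by
    rw [← hw, ← mul_sub, abs_mul, abs_of_pos hPa] at h
    refine le_of_mul_le_mul_left (h.trans_eq ?_) hPa
    ring
  rw [hK]
  rcases le_or_gt |u| v with huv | huv
  · have hsq : u ^ 2 ≤ v ^ 2 := sq_le_sq.mpr (huv.trans (le_abs_self v))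
    have hNP : N ≤ P := mul_le_mul_of_nonneg_left (antitone_psiDeriv hp hp1 hε hsq) (by positivity)
    have hmono : P * u ^ 2 ≤ N * v ^ 2 := by
      have := mul_le_mul_of_nonneg_left (psiDeriv_mul_le hp hε hsq)
        (show 0 ≤ 2 * β by positivity)
      rw [hP, hN]
      linarith
    obtain ⟨hu1, hu2⟩ := abs_le.mp huv
    have hlow : P * (2 * u - v) ≤ N * v := by
      rcases hv.eq_or_lt with hv0 | hv0
      · have : u = 0 := by linarith
        simp [this, ← hv0]
      · refine le_of_mul_le_mul_right ?_ hv0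
        nlinarith [mul_nonneg hP0.le (sq_nonneg (u - v))]
    have hup : N * v ≤ P * v := mul_le_mul_of_nonneg_right hNP hv
    have h1 : |(a + N) * v - (a + P) * u| ≤ (a + P) * (v - u) := by
      rw [abs_le]
      constructor <;> nlinarith
    rw [abs_of_nonneg (show 0 ≤ v - u by linarith)]
    have h2 : 0 ≤ (a + P) * (v - u) := mul_nonneg hPa.le (by linarith)
    nlinarith
  · have hy : 0 < |u| := hv.trans_lt huv
    have hsq : v ^ 2 ≤ u ^ 2 := sq_le_sq.mpr (by rw [abs_of_nonneg hv]; exact huv.le)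
    have hPN : P ≤ N := mul_le_mul_of_nonneg_left (antitone_psiDeriv hp hp1 hε hsq) (by positivity)
    have hδ : 0 < |u| - v := by linarith
    have key : N * v ≤ P * |u| + (a / 2 + (1 - p) / p * P) * (|u| - v) := by
      have h1 := mul_le_mul_of_nonneg_left (psi_sq_sub_le hp hp1 hε hv huv) hβ.le
      have h2 := hmin |u|
      rw [sq_abs] at h1 h2
      refine le_of_mul_le_mul_right ?_ hδ
      rw [hP]
      linarith
    have hCp : (1 - p) / p = 1 / p - 1 := by field_simp
    rw [hCp] at key
    have hgap : (a / 2 + (1 / p - 1) * P) * (|u| - v) ≤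
        (1 + 1 / p) * ((a + P) * (|u| - v)) := by
      have : a / 2 + (1 / p - 1) * P ≤ (1 + 1 / p) * (a + P) := by
        nlinarith [mul_pos hC ha]
      nlinarith
    have hX : 0 < (1 / p) * ((a + P) * (|u| - v)) := by positivity
    rcases le_total 0 u with hu | hu
    · rw [abs_of_nonneg hu] at *
      rw [abs_sub_comm v u, abs_of_pos hδ]
      have h3 : 0 ≤ (a + P) * (u - v) := by positivity
      have h4 : P * v ≤ N * v := mul_le_mul_of_nonneg_right hPN hv
      have h5 : 0 < a * (u - v) := by positivity
      rw [abs_le]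
      constructor <;> nlinarith
    · rw [abs_of_nonpos hu] at *
      rw [abs_of_nonneg (show 0 ≤ v - u by linarith)]
      have h4 : P * v ≤ N * v := mul_le_mul_of_nonneg_right hPN hv
      have h5 : 0 ≤ (a + P) * v := by positivity
      have h6 : 0 ≤ (a + P) * (-u) := mul_nonneg hPa.le (by linarith)
      have h7 : 0 ≤ 1 / p * ((a + P) * v) := by positivity
      have h8 : 0 ≤ a * (-u) := mul_nonneg ha.le (by linarith)
      have h9 : 0 ≤ a * v := by positivity
      have h10 : 0 ≤ P * v := by positivity
      rw [abs_le]
      constructor <;> nlinarith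

/-- The scalar form of the comparison of the two proximal points. -/
theorem scalar_prox_distance {p ε β α r u z v w : ℝ} (hp : 0 < p) (hp1 : p < 1)
    (hε : 0 < ε) (hβ : 0 < β) (hα : 0 ≤ α) (hr : 0 < r)
    (hv : ∀ s : ℝ, 1 / (2 * r) * (v - z) ^ 2 + β * psi p ε (v ^ 2) + α / 2 * v ^ 2 ≤
      1 / (2 * r) * (s - z) ^ 2 + β * psi p ε (s ^ 2) + α / 2 * s ^ 2)
    (hw : ∀ s : ℝ, 1 / (2 * r) * (w - z) ^ 2 +
        β * (psi p ε (u ^ 2) + psiDeriv p ε (u ^ 2) * (w ^ 2 - u ^ 2)) + α / 2 * w ^ 2 ≤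
      1 / (2 * r) * (s - z) ^ 2 +
        β * (psi p ε (u ^ 2) + psiDeriv p ε (u ^ 2) * (s ^ 2 - u ^ 2)) + α / 2 * s ^ 2) :
    |w - u| ≤ (4 + 2 / p) * |v - u| := by
  have hDv := psiDeriv_pos hp hε (v ^ 2)
  have hDu := psiDeriv_pos hp hε (u ^ 2)
  have ew := stationary_of_quadratic_min (m := β * psiDeriv p ε (u ^ 2)) (w := w) (z := z)
    hr hα (by positivity) fun s => by linarith [hw s]
  have ev := stationary_of_quadratic_min (m := β * psiDeriv p ε (v ^ 2)) (w := v) (z := z)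
    hr hα (by positivity) fun s => by
      have := mul_le_mul_of_nonneg_left
        (psi_le_tangent (t := v ^ 2) hp hp1 hε (sq_nonneg s)) hβ.le
      linarith [hv s]
  have ha : 0 < 1 / r + α := by positivity
  have hstat : (1 / r + α + 2 * β * psiDeriv p ε (u ^ 2)) * w =
      (1 / r + α + 2 * β * psiDeriv p ε (v ^ 2)) * v := by linarith
  have hmin : ∀ s : ℝ, 2 * β * psiDeriv p ε (v ^ 2) * v * (s - v) ≤
      (1 / r + α) / 2 * (s - v) ^ 2 + β * (psi p ε (s ^ 2) - psi p ε (v ^ 2)) := by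
    intro s
    have h1 : 1 / (2 * r) * (s - z) ^ 2 - 1 / (2 * r) * (v - z) ^ 2 =
        1 / r / 2 * (s ^ 2 - v ^ 2) - z / r * (s - v) := by
      field_simp
      ring
    rw [← ev] at h1
    linarith [hv s]
  rcases le_total 0 v with h | h
  · exact stationary_distance_of_nonneg hp hp1 hε hβ ha h hstat hmin
  · have := stationary_distance_of_nonneg (u := -u) (v := -v) (w := -w) hp hp1 hε hβ ha
      (by linarith) (by simp only [neg_sq]; linarith) fun s => by
        have := hmin (-s)
        simp only [neg_sq] at this ⊢
        linarith
    rwa [neg_sub_neg, neg_sub_neg, abs_sub_comm u w, abs_sub_comm u v] at this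

section

variable {X : Type*} [MeasurableSpace X] {μ : Measure X}

theorem integrable_sq_L2 (w : Lp ℝ 2 μ) : Integrable (fun x => w x ^ 2) μ :=
  (Lp.memLp w).integrable_sq

theorem norm_sq_eq_integral_sq (w : Lp ℝ 2 μ) : ‖w‖ ^ 2 = ∫ x, w x ^ 2 ∂μ := by
  rw [← real_inner_self_eq_norm_sq, L2.inner_def]
  refine integral_congr_ae (Eventually.of_forall fun x => ?_)
  simp [sq]

/-- A minimizer over `L²` of an integral functional with continuous integrand minimizes the
integrand pointwise almost everywhere. -/
theorem ae_forall_le_of_integral_min [IsFiniteMeasure μ] {F : X → ℝ → ℝ} {v : Lp ℝ 2 μ}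
    (hcont : ∀ x, Continuous (F x))
    (hint : ∀ w : Lp ℝ 2 μ, Integrable (fun x => F x (w x)) μ)
    (hmin : ∀ w : Lp ℝ 2 μ, ∫ x, F x (v x) ∂μ ≤ ∫ x, F x (w x) ∂μ) :
    ∀ᵐ x ∂μ, ∀ s, F x (v x) ≤ F x s := by
  have hconst : ∀ s : ℝ, ∀ᵐ x ∂μ, F x (v x) ≤ F x s := by
    intro s
    have hs : Integrable (fun x => F x s) μ := by
      refine (hint ((memLp_const s).toLp _)).congr ?_
      filter_upwards [(memLp_const (p := 2) (μ := μ) s).coeFn_toLp] with x hx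
      rw [hx]
    refine ae_le_of_forall_setIntegral_le (hint v) hs fun A hA _ => ?_
    classical
    have hmem : MemLp (A.piecewise (fun _ => s) v) 2 μ :=
      MemLp.piecewise hA ((memLp_const s).restrict A) ((Lp.memLp v).restrict Aᶜ)
    have h1 := hmin (hmem.toLp _)
    rw [← integral_add_compl hA (hint v), ← integral_add_compl hA (hint (hmem.toLp _))] at h1
    have h2 : ∫ x in A, F x (hmem.toLp _ x) ∂μ = ∫ x in A, F x s ∂μ := by
      refine setIntegral_congr_ae hA ?_
      filter_upwards [hmem.coeFn_toLp] with x hx hxA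
      rw [hx, Set.piecewise_eq_of_mem _ _ _ hxA]
    have h3 : ∫ x in Aᶜ, F x (hmem.toLp _ x) ∂μ = ∫ x in Aᶜ, F x (v x) ∂μ := by
      refine setIntegral_congr_ae hA.compl ?_
      filter_upwards [hmem.coeFn_toLp] with x hx hxA
      rw [hx, Set.piecewise_eq_of_notMem _ _ _ hxA]
    rw [h2, h3] at h1
    linarith
  have hrat : ∀ᵐ x ∂μ, ∀ s : ℚ, F x (v x) ≤ F x s := ae_all_iff.mpr fun s => hconst s
  filter_upwards [hrat] with x hx s
  exact Rat.denseRange_cast.induction_on s (isClosed_le continuous_const (hcont x)) hx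

/-- Pointwise form of minimality for a proximal functional
`w ↦ (1/(2r))‖w − z‖² + β ∫ G(x, w(x)) + (α/2)‖w‖²`. -/
theorem ae_forall_le_of_prox_min [IsFiniteMeasure μ] {G : X → ℝ → ℝ} {r β α : ℝ}
    {z v : Lp ℝ 2 μ} (hcont : ∀ x, Continuous (G x))
    (hint : ∀ w : Lp ℝ 2 μ, Integrable (fun x => G x (w x)) μ)
    (hmin : ∀ w : Lp ℝ 2 μ,
      1 / (2 * r) * ‖v - z‖ ^ 2 + β * ∫ x, G x (v x) ∂μ + α / 2 * ‖v‖ ^ 2 ≤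
        1 / (2 * r) * ‖w - z‖ ^ 2 + β * ∫ x, G x (w x) ∂μ + α / 2 * ‖w‖ ^ 2) :
    ∀ᵐ x ∂μ, ∀ s, 1 / (2 * r) * (v x - z x) ^ 2 + β * G x (v x) + α / 2 * v x ^ 2 ≤
      1 / (2 * r) * (s - z x) ^ 2 + β * G x s + α / 2 * s ^ 2 := by
  have hsub : ∀ w : Lp ℝ 2 μ,
      (fun x => (w - z : Lp ℝ 2 μ) x ^ 2) =ᵐ[μ] fun x => (w x - z x) ^ 2 := by
    intro w
    filter_upwards [Lp.coeFn_sub w z] with x hx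
    rw [hx, Pi.sub_apply]
  have hI1 : ∀ w : Lp ℝ 2 μ, Integrable (fun x => 1 / (2 * r) * (w x - z x) ^ 2) μ := fun w =>
    ((integrable_sq_L2 (w - z)).congr (hsub w)).const_mul _
  have hI2 : ∀ w : Lp ℝ 2 μ, Integrable (fun x => β * G x (w x)) μ := fun w =>
    (hint w).const_mul _
  have hI3 : ∀ w : Lp ℝ 2 μ, Integrable (fun x => α / 2 * w x ^ 2) μ := fun w =>
    (integrable_sq_L2 w).const_mul _
  have hval : ∀ w : Lp ℝ 2 μ,
      ∫ x, (1 / (2 * r) * (w x - z x) ^ 2 + β * G x (w x) + α / 2 * w x ^ 2) ∂μ =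
        1 / (2 * r) * ‖w - z‖ ^ 2 + β * ∫ x, G x (w x) ∂μ + α / 2 * ‖w‖ ^ 2 := by
    intro w
    rw [integral_add (f := fun x => 1 / (2 * r) * (w x - z x) ^ 2 + β * G x (w x))
      ((hI1 w).add (hI2 w)) (hI3 w), integral_add (hI1 w) (hI2 w),
      integral_const_mul, integral_const_mul, integral_const_mul, norm_sq_eq_integral_sq,
      norm_sq_eq_integral_sq, integral_congr_ae (hsub w)]
  refine ae_forall_le_of_integral_min
    (F := fun x s => 1 / (2 * r) * (s - z x) ^ 2 + β * G x s + α / 2 * s ^ 2) (fun x => ?_)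
    (fun w => ((hI1 w).add (hI2 w)).add (hI3 w)) fun w => ?_
  · have := hcont x
    fun_prop
  · rw [hval, hval]
    exact hmin w

theorem integrable_psi_sq [IsFiniteMeasure μ] {p ε : ℝ} (hp : 0 < p) (hp1 : p < 1)
    (hε : 0 < ε) (w : Lp ℝ 2 μ) : Integrable (fun x => psi p ε (w x ^ 2)) μ := by
  refine Integrable.mono' (g := fun x => psi p ε 0 + psiDeriv p ε 0 * (w x ^ 2 - 0))
    ((integrable_const _).add (((integrable_sq_L2 w).sub (integrable_const 0)).const_mul _))
    ((continuous_psi hp hε).comp_aestronglyMeasurable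
      (integrable_sq_L2 w).aestronglyMeasurable) (Eventually.of_forall fun x => ?_)
  rw [Real.norm_of_nonneg (psi_nonneg hp hp1 hε (sq_nonneg _))]
  exact psi_le_tangent hp hp1 hε (sq_nonneg _)

theorem integrable_psiDeriv_mul {p ε : ℝ} (hp : 0 < p) (hp1 : p < 1)
    (hε : 0 < ε) (u : Lp ℝ 2 μ) {f : X → ℝ} (hf : Integrable f μ) :
    Integrable (fun x => psiDeriv p ε (u x ^ 2) * f x) μ := by
  refine hf.bdd_mul (c := psiDeriv p ε 0)
    ((continuous_psiDeriv hε).comp_aestronglyMeasurable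
      (integrable_sq_L2 u).aestronglyMeasurable) (Eventually.of_forall fun x => ?_)
  rw [Real.norm_of_nonneg (psiDeriv_pos hp hε _).le]
  exact antitone_psiDeriv hp hp1 hε (sq_nonneg _)

end

/-- if `v` globally minimizes the smoothed proximal functional
`w ↦ (1/(2r))‖w − (u − r g)‖² + β∫_Ω ψ_ε(w²) + (α/2)‖w‖²` and `w*` globally minimizes
its convexification at `u` (the unique minimizer), then
`‖w* − u‖ ≤ (4 + 2/p)·‖v − u‖`. -/
theorem prox_distance_comparison
    {d : ℕ} (hd : 1 ≤ d) (Ω : Set (EuclideanSpace ℝ (Fin d)))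
    (hΩ_open : IsOpen Ω) (hΩ_conn : IsConnected Ω) (hΩ_bdd : Bornology.IsBounded Ω)
    (p ε β α r : ℝ) (hp0 : 0 < p) (hp1 : p < 1) (hε : 0 < ε) (hβ : 0 < β)
    (hα : 0 ≤ α) (hr : 0 < r)
    (u g v wstar : Lp ℝ 2 (volume.restrict Ω))
    (hv : ∀ w : Lp ℝ 2 (volume.restrict Ω),
      1 / (2 * r) * ‖v - (u - r • g)‖ ^ 2 +
          β * ∫ x, psi p ε (v x ^ 2) ∂(volume.restrict Ω) + α / 2 * ‖v‖ ^ 2 ≤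
        1 / (2 * r) * ‖w - (u - r • g)‖ ^ 2 +
          β * ∫ x, psi p ε (w x ^ 2) ∂(volume.restrict Ω) + α / 2 * ‖w‖ ^ 2)
    (hwstar : ∀ w : Lp ℝ 2 (volume.restrict Ω),
      1 / (2 * r) * ‖wstar - (u - r • g)‖ ^ 2 +
          β * ∫ x, (psi p ε (u x ^ 2) + psiDeriv p ε (u x ^ 2) * (wstar x ^ 2 - u x ^ 2))
            ∂(volume.restrict Ω) + α / 2 * ‖wstar‖ ^ 2 ≤
        1 / (2 * r) * ‖w - (u - r • g)‖ ^ 2 +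
          β * ∫ x, (psi p ε (u x ^ 2) + psiDeriv p ε (u x ^ 2) * (w x ^ 2 - u x ^ 2))
            ∂(volume.restrict Ω) + α / 2 * ‖w‖ ^ 2) :
    ‖wstar - u‖ ≤ (4 + 2 / p) * ‖v - u‖ := by
  have : IsFiniteMeasure (volume.restrict Ω) :=
    isFiniteMeasure_restrict.mpr hΩ_bdd.measure_lt_top.ne
  have h1 := ae_forall_le_of_prox_min (G := fun _ s => psi p ε (s ^ 2))
    (fun _ => (continuous_psi hp0 hε).comp (continuous_pow 2))
    (fun w => integrable_psi_sq hp0 hp1 hε w) hv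
  have h2 := ae_forall_le_of_prox_min
    (G := fun x s => psi p ε (u x ^ 2) + psiDeriv p ε (u x ^ 2) * (s ^ 2 - u x ^ 2))
    (fun _ => by fun_prop)
    (fun w => (integrable_psi_sq hp0 hp1 hε u).add (integrable_psiDeriv_mul hp0 hp1 hε u
      ((integrable_sq_L2 w).sub (integrable_sq_L2 u)))) hwstar
  refine Lp.norm_le_mul_norm_of_ae_le_mul ?_
  filter_upwards [h1, h2, Lp.coeFn_sub wstar u, Lp.coeFn_sub v u] with x hx1 hx2 hx3 hx4
  rw [hx3, hx4]
  exact scalar_prox_distance hp0 hp1 hε hβ hα hr hx1 hx2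
end
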